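/- There is no infinite sequence f₀, f₁, f₂, … of tilings of Δ in which each f_{k+1} is obtained from f_k by a GD flip; that is, the GD-flip relation on tilings admits no infinite descending chain. -/

import Mathlib

/-- The upward unit triangles of the side-`n` triangle Δ: pairs `(i,j)` with `i+j ≤ n-1`. -/
def UpTri (n : ℕ) : Set (ℕ × ℕ) := {p | p.1 + p.2 + 1 ≤ n}

/-- The downward unit triangles of Δ: pairs `(i,j)` with `i+j ≤ n-2`. -/
def DownTri (n : ℕ) : Set (ℕ × ℕ) := {p | p.1 + p.2 + 2 ≤ n}

/-- The downward unit triangle `d` is adjacent to exactly the upward unit triangles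
`d`, `(d.1+1, d.2)` and `(d.1, d.2+1)`. -/
def Adj (d u : ℕ × ℕ) : Prop :=
  u = d ∨ u = (d.1 + 1, d.2) ∨ u = (d.1, d.2 + 1)

/-- A fine mixed subdivision (tiling) of Δ with hole set `S`: a bijection `f` from the
downward unit triangles onto the upward unit triangles not in `S`, with `f d` adjacent
to `d` for every `d`. -/
def IsTiling (n : ℕ) (S : Set (ℕ × ℕ)) (f : ℕ × ℕ → ℕ × ℕ) : Prop :=
  Set.BijOn f (DownTri n) (UpTri n \ S) ∧ ∀ d ∈ DownTri n, Adj d (f d)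

/-- The upward unit triangles of the upward subtriangle `T(a,b,k)`. -/
def UpCells (a b k : ℕ) : Set (ℕ × ℕ) :=
  {p | a ≤ p.1 ∧ b ≤ p.2 ∧ p.1 + p.2 + 1 ≤ a + b + k}

/-- The downward unit triangles of the upward subtriangle `T(a,b,k)`. -/
def DownCells (a b k : ℕ) : Set (ℕ × ℕ) :=
  {p | a ≤ p.1 ∧ b ≤ p.2 ∧ p.1 + p.2 + 2 ≤ a + b + k}

/-- `S` is spread-out: every upward subtriangle of size `k` contains at most `k` holes. -/
def SpreadOut (n : ℕ) (S : Finset (ℕ × ℕ)) : Prop :=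
  ∀ a b k : ℕ, a + b + k ≤ n →
    (S.filter (fun p => a ≤ p.1 ∧ b ≤ p.2 ∧ p.1 + p.2 + 1 ≤ a + b + k)).card ≤ k

/-- The upward unit triangles of the GD ring `R(a,b,m)`: upward cells of `T(a,b,m)` other
than the three corners and the cells of the central subtriangle `T(a+1,b+1,m-3)`. -/
def RingUp (a b m : ℕ) : Set (ℕ × ℕ) :=
  UpCells a b m \ ({(a, b), (a + m - 1, b), (a, b + m - 1)} ∪ UpCells (a + 1) (b + 1) (m - 3))

/-- The downward unit triangles of the GD ring `R(a,b,m)`. -/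
def RingDown (a b m : ℕ) : Set (ℕ × ℕ) :=
  DownCells a b m \ DownCells (a + 1) (b + 1) (m - 3)

/-- `f` contains a clockwise GD at `(a,b,m)`. -/
def CWGD (f : ℕ × ℕ → ℕ × ℕ) (a b m : ℕ) : Prop :=
  f '' RingDown a b m = RingUp a b m ∧ f (a, b) = (a, b + 1)

/-- `f` contains a counterclockwise GD at `(a,b,m)`. -/
def CCWGD (f : ℕ × ℕ → ℕ × ℕ) (a b m : ℕ) : Prop :=
  f '' RingDown a b m = RingUp a b m ∧ f (a, b) = (a + 1, b)

/-- `g` is obtained from `f` by a GD flip at `(a,b,m)`. -/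
def GDFlipAt (n : ℕ) (f g : ℕ × ℕ → ℕ × ℕ) (a b m : ℕ) : Prop :=
  3 ≤ m ∧ a + b + m ≤ n ∧ CWGD f a b m ∧ CCWGD g a b m ∧
    (∃ S : Set (ℕ × ℕ), IsTiling n S f ∧ IsTiling n S g) ∧
    ∀ d ∈ DownTri n, d ∉ RingDown a b m → g d = f d

/-- `g` is obtained from `f` by a GD flip (at some position). -/
def GDFlip (n : ℕ) (f g : ℕ × ℕ → ℕ × ℕ) : Prop :=
  ∃ a b m, GDFlipAt n f g a b m

open Classical in
/-- The weight of a rhombus: `n - j` if `f` pairs `(i,j)` with `(i+1,j)`, otherwise `0`. -/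
noncomputable def gdWeight (n : ℕ) (f : ℕ × ℕ → ℕ × ℕ) (d : ℕ × ℕ) : ℕ :=
  if f d = (d.1 + 1, d.2) then n - d.2 else 0

/-- The downward triangles as a finset. -/
def gdDown (n : ℕ) : Finset (ℕ × ℕ) :=
  (Finset.range n ×ˢ Finset.range n).filter (fun d => d.1 + d.2 + 2 ≤ n)

lemma mem_gdDown (n : ℕ) (d : ℕ × ℕ) : d ∈ gdDown n ↔ d ∈ DownTri n := by
  simp only [gdDown, DownTri, Finset.mem_filter, Finset.mem_product, Finset.mem_range,
    Set.mem_ofPred_eq]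
  omega

lemma mem_ringDown (a b m i j : ℕ) (hm : 3 ≤ m) : (i, j) ∈ RingDown a b m ↔
    (a ≤ i ∧ b ≤ j ∧ i + j + 2 ≤ a + b + m) ∧ (i = a ∨ j = b ∨ i + j + 2 = a + b + m) := by
  simp only [RingDown, DownCells, Set.mem_sdiff, Set.mem_ofPred_eq]
  omega

lemma mem_ringUp (a b m i j : ℕ) (hm : 3 ≤ m) : (i, j) ∈ RingUp a b m ↔
    (a ≤ i ∧ b ≤ j ∧ i + j + 1 ≤ a + b + m) ∧ (i = a ∨ j = b ∨ i + j + 1 = a + b + m) ∧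
    ¬ (i = a ∧ j = b) ∧ ¬ (i = a + m - 1 ∧ j = b) ∧ ¬ (i = a ∧ j = b + m - 1) := by
  simp only [RingUp, UpCells, Set.mem_sdiff, Set.mem_ofPred_eq, Set.mem_union, Set.mem_insert_iff,
    Set.mem_singleton_iff, Prod.mk.injEq]
  omega

/-- In a clockwise GD, the bottom cells other than the first are matched to themselves. -/
lemma cw_bottom {n a b m : ℕ} {f : ℕ × ℕ → ℕ × ℕ} {S : Set (ℕ × ℕ)} (hm : 3 ≤ m)
    (hab : a + b + m ≤ n) (hcw : CWGD f a b m) (hf : IsTiling n S f) (i : ℕ) (hi : i + 3 ≤ m) :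
    f (a + i + 1, b) = (a + i + 1, b) := by
  induction i with
  | zero =>
    have h : (a + 0 + 1, b) ∈ RingUp a b m := by
      rw [mem_ringUp _ _ _ _ _ hm]; omega
    rw [← hcw.1] at h
    obtain ⟨⟨x, y⟩, hd, he⟩ := h
    rw [mem_ringDown _ _ _ _ _ hm] at hd
    have hadj := hf.2 (x, y) (by simp only [DownTri, Set.mem_ofPred_eq]; omega)
    have h0 := hcw.2
    simp only [Adj, he, Prod.mk.injEq] at hadj
    rcases hadj with h1 | h1 | h1
    · obtain ⟨rfl, rfl⟩ := h1; exact he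
    · have : x = a := by omega
      obtain rfl := this
      obtain ⟨_, rfl⟩ := h1
      rw [h0] at he; simp at he
    · omega
  | succ i ih =>
    have ih := ih (by omega)
    have h : (a + (i + 1) + 1, b) ∈ RingUp a b m := by
      rw [mem_ringUp _ _ _ _ _ hm]; omega
    rw [← hcw.1] at h
    obtain ⟨⟨x, y⟩, hd, he⟩ := h
    rw [mem_ringDown _ _ _ _ _ hm] at hd
    have hadj := hf.2 (x, y) (by simp only [DownTri, Set.mem_ofPred_eq]; omega)
    simp only [Adj, he, Prod.mk.injEq] at hadj
    rcases hadj with h1 | h1 | h1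
    · obtain ⟨rfl, rfl⟩ := h1; exact he
    · have : x = a + i + 1 := by omega
      obtain rfl := this
      obtain ⟨_, rfl⟩ := h1
      rw [ih] at he; simp only [Prod.mk.injEq] at he; omega
    · omega

/-- In a clockwise GD, the type-1 rhombi are on the hypotenuse. -/
lemma cw_type_one {n a b m : ℕ} {f : ℕ × ℕ → ℕ × ℕ} {S : Set (ℕ × ℕ)} (hm : 3 ≤ m)
    (hab : a + b + m ≤ n) (hcw : CWGD f a b m) (hf : IsTiling n S f) (i j : ℕ)
    (hd : (i, j) ∈ RingDown a b m) (h1 : f (i, j) = (i + 1, j)) :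
    a ≤ i ∧ b < j ∧ i + j + 2 = a + b + m := by
  have hup : (i + 1, j) ∈ RingUp a b m := by
    rw [← hcw.1, ← h1]; exact Set.mem_image_of_mem _ hd
  rw [mem_ringUp _ _ _ _ _ hm] at hup
  rw [mem_ringDown _ _ _ _ _ hm] at hd
  have hjb : j ≠ b := by
    rintro rfl
    by_cases hia : i = a
    · subst hia
      rw [hcw.2] at h1; simp at h1
    · have := cw_bottom hm hab hcw hf (i - a - 1) (by omega)
      rw [show a + (i - a - 1) + 1 = i by omega, h1] at this
      simp at this
  omega

/-- In a counterclockwise GD, the bottom rhombi are of type 1. -/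
lemma ccw_bottom {n a b m : ℕ} {f : ℕ × ℕ → ℕ × ℕ} {S : Set (ℕ × ℕ)} (hm : 3 ≤ m)
    (hab : a + b + m ≤ n) (hcw : CCWGD f a b m) (hf : IsTiling n S f) (i : ℕ) (hi : i + 3 ≤ m) :
    f (a + i, b) = (a + i + 1, b) := by
  induction i with
  | zero => exact hcw.2
  | succ i ih =>
    have ih := ih (by omega)
    have hd : (a + (i + 1), b) ∈ RingDown a b m := by
      rw [mem_ringDown _ _ _ _ _ hm]; omega
    have hup : f (a + (i + 1), b) ∈ RingUp a b m := by
      rw [← hcw.1]; exact Set.mem_image_of_mem _ hd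
    have hT : (a + (i + 1), b) ∈ DownTri n := by
      simp only [DownTri, Set.mem_ofPred_eq]; omega
    have hT' : (a + i, b) ∈ DownTri n := by
      simp only [DownTri, Set.mem_ofPred_eq]; omega
    rcases hf.2 _ hT with h1 | h1 | h1
    · have := hf.1.injOn hT hT' (by rw [h1, ih, Nat.add_assoc])
      simp at this
    · exact h1
    · rw [h1, mem_ringUp _ _ _ _ _ hm] at hup
      simp only at hup
      omega

open Classical in
lemma gd_potential_lt {n : ℕ} {f g : ℕ × ℕ → ℕ × ℕ} (h : GDFlip n f g) :
    ∑ d ∈ gdDown n, gdWeight n f d < ∑ d ∈ gdDown n, gdWeight n g d := by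
  obtain ⟨a, b, m, hm, hab, hcw, hccw, ⟨S, hf, hg⟩, hout⟩ := h
  rw [← Finset.sum_filter_add_sum_filter_not (gdDown n) (fun d => d ∈ RingDown a b m),
    ← Finset.sum_filter_add_sum_filter_not (gdDown n) (fun d => d ∈ RingDown a b m)
      (gdWeight n g)]
  refine add_lt_add_of_lt_of_le ?_ (le_of_eq ?_)
  swap
  · refine Finset.sum_congr rfl fun d hd => ?_
    rw [Finset.mem_filter, mem_gdDown] at hd
    simp only [gdWeight, hout d hd.1 hd.2]
  set R := (gdDown n).filter (fun d => d ∈ RingDown a b m) with hR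
  have hmemR : ∀ d, d ∈ RingDown a b m → d ∈ R := by
    rintro ⟨i, j⟩ hd
    rw [hR, Finset.mem_filter, mem_gdDown]
    refine ⟨?_, hd⟩
    rw [mem_ringDown _ _ _ _ _ hm] at hd
    simp only [DownTri, Set.mem_ofPred_eq]; omega
  have hA : ∀ d ∈ R.filter (fun d => f d = (d.1 + 1, d.2)),
      a ≤ d.1 ∧ b < d.2 ∧ d.1 + d.2 + 2 = a + b + m := by
    rintro ⟨i, j⟩ hd
    rw [Finset.mem_filter, hR, Finset.mem_filter] at hd
    exact cw_type_one hm hab hcw hf i j hd.1.2 hd.2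
  have hcard : (R.filter (fun d => f d = (d.1 + 1, d.2))).card ≤ m - 2 := by
    have := Finset.card_le_card_of_injOn (s := R.filter (fun d => f d = (d.1 + 1, d.2)))
      (t := Finset.Ico a (a + (m - 2))) Prod.fst
      (by
        intro d hd
        have := hA d hd
        simp only [Finset.coe_Ico, Set.mem_Ico]; omega)
      (by
        intro d hd e he hde
        have h1 := hA d hd
        have h2 := hA e he
        ext <;> omega)
    simpa using this
  have h1 : ∑ d ∈ R, gdWeight n f d ≤ (m - 2) * (n - b - 1) := by
    simp only [gdWeight]
    rw [← Finset.sum_filter]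
    calc _ ≤ (R.filter (fun d => f d = (d.1 + 1, d.2))).card • (n - b - 1) := by
          refine Finset.sum_le_card_nsmul _ _ _ fun d hd => ?_
          have := hA d hd
          omega
      _ ≤ _ := by
          rw [smul_eq_mul]; exact Nat.mul_le_mul_right _ hcard
  have h2 : (m - 2) * (n - b) ≤ ∑ d ∈ R, gdWeight n g d := by
    have hsub : (Finset.range (m - 2)).image (fun t => (a + t, b)) ⊆ R := by
      intro d hd
      simp only [Finset.mem_image, Finset.mem_range] at hd
      obtain ⟨t, ht, rfl⟩ := hd
      apply hmemR
      rw [mem_ringDown _ _ _ _ _ hm]; omega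
    refine le_trans (le_of_eq ?_) (Finset.sum_le_sum_of_subset hsub)
    rw [Finset.sum_image (by intro x _ y _ hxy; simpa using hxy)]
    rw [Finset.sum_congr rfl (g := fun _ => n - b)]
    · simp
    · intro t ht
      rw [Finset.mem_range] at ht
      simp only [gdWeight, ccw_bottom hm hab hccw hg t (by omega), if_true]
  have h3 : (m - 2) * (n - b - 1) < (m - 2) * (n - b) :=
    Nat.mul_lt_mul_of_pos_left (by omega) (by omega)
  omega

/-- There is no infinite sequence of tilings of Δ in which each one is
obtained from the previous one by a GD flip. -/
theorem no_infinite_gd_flip_chain (n : ℕ) (hn : 0 < n) :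
    ¬ ∃ F : ℕ → ℕ × ℕ → ℕ × ℕ, ∀ k : ℕ, GDFlip n (F k) (F (k + 1)) := by
  rintro ⟨F, hF⟩
  have hmono : StrictMono (fun k => ∑ d ∈ gdDown n, gdWeight n (F k) d) :=
    strictMono_nat_of_lt_succ fun k => gd_potential_lt (hF k)
  have hb : ∀ k, ∑ d ∈ gdDown n, gdWeight n (F k) d ≤ (gdDown n).card * n := by
    intro k
    have := Finset.sum_le_card_nsmul (gdDown n) (gdWeight n (F k)) n (fun d _ => by
      simp only [gdWeight]; split_ifs <;> omega)
    simpa using this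
  have h1 := hmono.le_apply (x := (gdDown n).card * n + 1)
  have h2 := hb ((gdDown n).card * n + 1)
  omega
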